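/- arXiv:2506.00529 — 2 statements merged into one kernel-verified Lean document; each statement's English description precedes it below -/
import Mathlib

section
/- Let R be a commutative Noetherian ring and r ≥ 1. Let S = ⊕_{n∈ℕ^r} S_n be a Noetherian standard ℕ^r-graded ring with S_0 = R, and let ℳ = ⊕_{n∈ℤ^r} ℳ_n be a finitely generated ℤ^r-graded S-module. Let J be a nonzero ideal of R. Let f : K → L be an R-linear map between finitely generated R-modules and let F denote the associated coherent functor, F(X) := Hom_R(K,X) / {g ∘ f : g ∈ Hom_R(L,X)}. Then grade(J, F(ℳ_n)) stabilizes: there exists c ∈ ℕ^r such that grade(J, F(ℳ_n)) = grade(J, F(ℳ_c)) for all n ∈ ℤ^r with n ≥ c. -/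
universe u

open CategoryTheory

/-- The value of the coherent functor presented by `f : K →ₗ[R] L` on a module `X`:
`F(X) = Hom_R(K, X) / {g ∘ f : g ∈ Hom_R(L, X)}`. -/
abbrev coherentApply {R K L : Type u} [CommRing R] [AddCommGroup K] [Module R K]
    [AddCommGroup L] [Module R L] (f : K →ₗ[R] L)
    (X : Type u) [AddCommGroup X] [Module R X] : Type u :=
  (K →ₗ[R] X) ⧸ LinearMap.range (LinearMap.lcomp R X f)

/-- `grade(J, X)`: the infimum in `ℕ∞` of the set `{i ∈ ℕ : Ext_R^i(R/J, X) ≠ 0}`. -/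
noncomputable def gradeIdeal {R : Type u} [CommRing R] (J : Ideal R)
    (X : Type u) [AddCommGroup X] [Module R X] : ℕ∞ :=
  sInf {n : ℕ∞ | ∃ m : ℕ, n = m ∧
    Nontrivial (((Ext R (ModuleCat.{u} R) m).obj
      (Opposite.op (ModuleCat.of R (R ⧸ J)))).obj (ModuleCat.of R X))}

section ExtPart

open Abelian Pointwise

lemma oldExt_subsingleton_iff {R : Type u} [CommRing R] {X Y : ModuleCat.{u} R}
    (P : ProjectiveResolution X) (p n m : ℕ) (hp : (ComplexShape.up ℕ).prev n = p) (hm : n + 1 = m) :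
    Subsingleton (((Ext R (ModuleCat.{u} R) n).obj (Opposite.op X)).obj Y) ↔
      ∀ φ : P.complex.X n ⟶ Y, P.complex.d m n ≫ φ = 0 → ∃ ψ : P.complex.X p ⟶ Y,
        P.complex.d n p ≫ ψ = φ := by
  have e := (P.isoExt (R := R) n Y).toLinearEquiv.toEquiv
  rw [e.subsingleton_congr, ← ModuleCat.isZero_iff_subsingleton,
    ← HomologicalComplex.exactAt_iff_isZero_homology,
    HomologicalComplex.exactAt_iff' _ p n m hp (by simpa using hm),
    ShortComplex.moduleCat_exact_iff]
  exact Iff.rfl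

lemma newExt_subsingleton_iff {R : Type u} [CommRing R] {X Y : ModuleCat.{u} R}
    (P : ProjectiveResolution X) (p n m : ℕ) (hp : p + 1 = n) (hm : n + 1 = m) :
    Subsingleton (Abelian.Ext X Y n) ↔
      ∀ φ : P.complex.X n ⟶ Y, P.complex.d m n ≫ φ = 0 → ∃ ψ : P.complex.X p ⟶ Y,
        P.complex.d n p ≫ ψ = φ := by
  constructor
  · intro h φ hφ
    exact (P.extMk_eq_zero_iff φ m hm hφ p hp).1 (Subsingleton.elim _ _)
  · intro h
    refine ⟨fun a b => ?_⟩
    have key : ∀ a : Abelian.Ext X Y n, a = 0 := by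
      intro a
      obtain ⟨φ, hφ, rfl⟩ := P.extMk_surjective a m hm
      exact (P.extMk_eq_zero_iff φ m hm hφ p hp).2 (h φ hφ)
    rw [key a, key b]

lemma old_new {R : Type u} [CommRing R] (X Y : ModuleCat.{u} R) (n : ℕ) :
    Subsingleton (((_root_.Ext R (ModuleCat.{u} R) n).obj (Opposite.op X)).obj Y) ↔
      Subsingleton (Abelian.Ext X Y n) := by
  obtain ⟨P⟩ := (inferInstance : HasProjectiveResolution X)
  obtain ⟨P⟩ := P
  cases n with
  | succ n =>
    rw [oldExt_subsingleton_iff P n (n+1) (n+2) (by simp) rfl,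
      newExt_subsingleton_iff P n (n+1) (n+2) rfl rfl]
  | zero =>
    rw [oldExt_subsingleton_iff P 0 0 1 (by simp) rfl]
    rw [Abelian.Ext.homEquiv₀.subsingleton_congr]
    have hd : P.complex.d 0 0 = 0 := P.complex.shape _ _ (by simp)
    simp only [hd, Limits.zero_comp]
    constructor
    · intro h
      have key : ∀ a : ((ChainComplex.single₀ (ModuleCat R)).obj X).X 0 ⟶ Y, a = 0 := by
        intro a
        obtain ⟨_, ha⟩ := h (P.π.f 0 ≫ a) (by
          rw [← Category.assoc, P.complex_d_comp_π_f_zero, Limits.zero_comp])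
        exact (cancel_epi (P.π.f 0)).1 (ha.symm.trans Limits.comp_zero.symm)
      exact ⟨fun a b => (key a).trans (key b).symm⟩
    · intro h φ hφ
      have hex := P.exact₀
      refine ⟨0, ?_⟩
      have : φ = (P.π.f 0) ≫ hex.desc φ hφ := (hex.g_desc φ hφ).symm
      have h0 : hex.desc φ hφ = 0 := @Subsingleton.elim _ h _ _
      rw [this, h0, Limits.comp_zero]

variable {R : Type u} [CommRing R]

lemma gradeIdeal_eq (J : Ideal R) (X : Type u) [AddCommGroup X] [Module R X] :
    gradeIdeal J X = sInf {n : ℕ∞ | ∃ m : ℕ, n = m ∧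
      Nontrivial (Abelian.Ext (ModuleCat.of R (R ⧸ J)) (ModuleCat.of R X) m)} := by
  unfold gradeIdeal
  congr 1
  ext n
  simp only [Set.mem_ofPred_eq, ← not_subsingleton_iff_nontrivial, old_new]

lemma gradeIdeal_congr (J : Ideal R) {X Y : Type u} [AddCommGroup X] [Module R X]
    [AddCommGroup Y] [Module R Y] (e : X ≃ₗ[R] Y) : gradeIdeal J X = gradeIdeal J Y := by
  unfold gradeIdeal
  congr 1
  ext n
  have (m : ℕ) := (((Ext R (ModuleCat.{u} R) m).obj
      (Opposite.op (ModuleCat.of R (R ⧸ J)))).mapIso e.toModuleIso).toLinearEquiv.toEquiv.nontrivial_congr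
  simp only [Set.mem_ofPred_eq, this]

lemma gradeIdeal_eq_zero (J : Ideal R) {X : Type u} [AddCommGroup X] [Module R X]
    (y : X) (hy : y ≠ 0) (hJ : ∀ a ∈ J, a • y = 0) : gradeIdeal J X = 0 := by
  rw [gradeIdeal_eq]
  refine le_antisymm (sInf_le ⟨0, by simp, ?_⟩) bot_le
  rw [Abelian.Ext.homEquiv₀.nontrivial_congr]
  let g : (R ⧸ J) →ₗ[R] X := Submodule.liftQ J (LinearMap.toSpanSingleton R X y)
    (fun a ha => by simpa using hJ a ha)
  refine ⟨ModuleCat.ofHom g, 0, fun h => hy ?_⟩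
  have := congrArg (fun k => k.hom (Submodule.Quotient.mk 1)) h
  have h1 : g (Submodule.Quotient.mk 1) = y := by
    change (LinearMap.toSpanSingleton R X y) 1 = y
    simp
  exact h1.symm.trans this

lemma ext_killed (J : Ideal R) (M : ModuleCat.{u} R) (x : R) (hx : x ∈ J) (n : ℕ)
    (a : Abelian.Ext (ModuleCat.of R (R ⧸ J)) M n) :
    a.comp (Ext.mk₀ (x • 𝟙 M)) (add_zero n) = 0 := by
  have h0 : x • 𝟙 (ModuleCat.of R (R ⧸ J)) = 0 := by
    ext
    change x • (Ideal.Quotient.mk J 1) = 0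
    rw [← Ideal.Quotient.mk_eq_mk, ← Submodule.Quotient.mk_smul,
      Submodule.Quotient.mk_eq_zero]
    simpa using hx
  rw [← Ext.smul_eq_comp_mk₀]
  conv_lhs => rw [← Ext.mk₀_id_comp a]
  rw [← Ext.smul_comp, ← Ext.mk₀_smul, h0]
  simp

lemma gradeIdeal_succ (J : Ideal R) {X : Type u} [AddCommGroup X] [Module R X]
    (x : R) (hx : x ∈ J) (hreg : IsSMulRegular X x) :
    gradeIdeal J X = gradeIdeal J (X ⧸ x • (⊤ : Submodule R X)) + 1 := by
  have hS := IsSMulRegular.smulShortComplex_shortExact (M := ModuleCat.of R X) hreg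
  set Q := ModuleCat.of R (R ⧸ J)
  set E : ℕ → Prop := fun m => Subsingleton (Abelian.Ext Q (ModuleCat.of R X) m)
  set E' : ℕ → Prop := fun m => Subsingleton (Abelian.Ext Q
    (ModuleCat.of R (X ⧸ x • (⊤ : Submodule R X))) m)
  have sub0 : ∀ {G : Type u} [AddCommGroup G], Subsingleton G ↔ ∀ a : G, a = 0 :=
    fun {G} _ => ⟨fun h a => Subsingleton.elim _ _, fun h => ⟨fun a b => by rw [h a, h b]⟩⟩
  have h1 : E 0 := by
    refine sub0.2 fun a => ?_
    have h := ext_killed J (ModuleCat.of R X) x hx 0 a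
    have := hS.mono_f
    exact Ext.postcomp_mk₀_injective_of_mono Q (ModuleCat.smulShortComplex (ModuleCat.of R X) x).f
      (h.trans (map_zero _).symm)
  have h2 : ∀ m, E m → E (m+1) → E' m := by
    intro m a b
    refine sub0.2 fun y => ?_
    obtain ⟨z, rfl⟩ := Ext.covariant_sequence_exact₃ Q hS y rfl (@Subsingleton.elim _ b _ _)
    have hz : z = 0 := @Subsingleton.elim _ a _ _
    rw [hz, Ext.zero_comp]
    rfl
  have h3 : ∀ m, E' m → E (m+1) := by
    intro m a
    refine sub0.2 fun y => ?_
    obtain ⟨z, rfl⟩ := Ext.covariant_sequence_exact₁ Q hS y (ext_killed J _ x hx _ y) rfl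
    have hz : z = 0 := @Subsingleton.elim _ a _ _
    rw [hz, Ext.zero_comp]
    rfl
  rw [gradeIdeal_eq, gradeIdeal_eq]
  simp only [← not_subsingleton_iff_nontrivial]
  change sInf {n : ℕ∞ | ∃ m : ℕ, n = m ∧ ¬ E m} = sInf {n : ℕ∞ | ∃ m : ℕ, n = m ∧ ¬ E' m} + 1
  apply le_antisymm
  · by_cases hne : ∃ m, ¬ E' m
    · classical
      have hmem : sInf {n : ℕ∞ | ∃ m : ℕ, n = m ∧ ¬ E' m} ∈ {n : ℕ∞ | ∃ m : ℕ, n = m ∧ ¬ E' m} :=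
        csInf_mem (by obtain ⟨m, hm⟩ := hne; exact ⟨(m : ℕ∞), m, rfl, hm⟩)
      obtain ⟨m, hm, hE⟩ := hmem
      rw [hm]
      by_cases hEm : E m
      · exact sInf_le ⟨m + 1, by simp, fun h => hE (h2 m hEm h)⟩
      · exact le_trans (sInf_le ⟨m, rfl, hEm⟩) le_self_add
    · have : {n : ℕ∞ | ∃ m : ℕ, n = m ∧ ¬ E' m} = ∅ := by
        ext n; simp only [Set.mem_ofPred_eq, Set.mem_empty_iff_false, iff_false]
        rintro ⟨m, _, h⟩; exact hne ⟨m, h⟩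
      rw [this]; simp
  · refine le_sInf ?_
    rintro _ ⟨m, rfl, hm⟩
    cases m with
    | zero => exact absurd h1 hm
    | succ m =>
      push_cast
      gcongr
      exact sInf_le ⟨m, rfl, fun h => hm (h3 m h)⟩

end ExtPart

section GradedPart

/-- The data of a graded module, expressed with projections. -/
structure GrData {R S H : Type u} {r : ℕ} [CommRing R] [CommRing S] [Algebra R S]
    [AddCommGroup H] [Module R H] [Module S H]
    (𝒜 : (Fin r → ℕ) → Submodule R S) (Hn : (Fin r → ℤ) → Submodule R H)
    (π : (Fin r → ℤ) → H →ₗ[R] H) : Prop where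
  mem : ∀ n h, π n h ∈ Hn n
  self : ∀ n, ∀ h ∈ Hn n, π n h = h
  ne : ∀ n d, ∀ h ∈ Hn d, n ≠ d → π n h = 0
  smul : ∀ m, ∀ s ∈ 𝒜 m, ∀ n h, π (fun i => n i + (m i : ℤ)) (s • h) = s • π n h
  sum : ∀ h, ∃ t : Finset (Fin r → ℤ), h = ∑ n ∈ t, π n h

variable {R S H : Type u} {r : ℕ} [CommRing R] [CommRing S] [Algebra R S]
    [AddCommGroup H] [Module R H] [Module S H] [IsScalarTower R S H]
    {𝒜 : (Fin r → ℕ) → Submodule R S} {Hn : (Fin r → ℤ) → Submodule R H}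
    {π : (Fin r → ℤ) → H →ₗ[R] H}

lemma mul_deg (hstd : ∀ n : Fin r → ℕ, 𝒜 n = ∏ i, 𝒜 (Pi.single i 1) ^ n i)
    (a b : Fin r → ℕ) : 𝒜 (a + b) = 𝒜 a * 𝒜 b := by
  rw [hstd (a + b), hstd a, hstd b, ← Finset.prod_mul_distrib]
  simp [pow_add]

lemma smul_mem_of_le (hstd : ∀ n : Fin r → ℕ, 𝒜 n = ∏ i, 𝒜 (Pi.single i 1) ^ n i)
    (P : Submodule S H) {b m : Fin r → ℕ} (hbm : b ≤ m) (h : H) (hb : ∀ u ∈ 𝒜 b, u • h ∈ P) :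
    ∀ s ∈ 𝒜 m, s • h ∈ P := by
  intro s hs
  rw [← tsub_add_cancel_of_le hbm, mul_deg hstd] at hs
  refine Submodule.mul_induction_on hs ?_ ?_
  · intro u _ v hv
    rw [mul_smul]
    exact P.smul_mem _ (hb v hv)
  · intro u v hu hv
    rw [add_smul]
    exact P.add_mem hu hv

/-- Saturation of a submodule. -/
def satur (hstd : ∀ n : Fin r → ℕ, 𝒜 n = ∏ i, 𝒜 (Pi.single i 1) ^ n i)
    (P : Submodule S H) : Submodule S H where
  carrier := {h | ∃ k : ℕ, ∀ s ∈ 𝒜 (fun _ => k), s • h ∈ P}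
  zero_mem' := ⟨0, fun s _ => by simp⟩
  add_mem' := by
    rintro a b ⟨k, hk⟩ ⟨l, hl⟩
    refine ⟨max k l, fun s hs => ?_⟩
    rw [smul_add]
    exact P.add_mem (smul_mem_of_le hstd P (fun _ => le_max_left k l) a hk s hs)
      (smul_mem_of_le hstd P (fun _ => le_max_right k l) b hl s hs)
  smul_mem' := by
    rintro c a ⟨k, hk⟩
    refine ⟨k, fun s hs => ?_⟩
    rw [smul_comm]
    exact P.smul_mem _ (hk s hs)

variable (hstd : ∀ n : Fin r → ℕ, 𝒜 n = ∏ i, 𝒜 (Pi.single i 1) ^ n i)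

lemma le_satur (P : Submodule S H) : P ≤ satur hstd P :=
  fun _ hh => ⟨0, fun s _ => P.smul_mem s hh⟩

lemma satur_hom (D : GrData 𝒜 Hn π) (P : Submodule S H) (hP : ∀ h ∈ P, ∀ n, π n h ∈ P) :
    ∀ h ∈ satur hstd P, ∀ n, π n h ∈ satur hstd P := by
  rintro h ⟨k, hk⟩ n
  refine ⟨k, fun s hs => ?_⟩
  rw [← D.smul _ s hs]
  exact hP _ (hk s hs) _

lemma satur_bound [GradedAlgebra 𝒜] [IsNoetherian S H] (D : GrData 𝒜 Hn π) (P : Submodule S H) :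
    ∃ c : Fin r → ℕ, ∀ n : Fin r → ℤ, (∀ i, (c i : ℤ) ≤ n i) →
      ∀ h ∈ Hn n, h ∈ satur hstd P → h ∈ P := by
  classical
  set X : Set H := {h | ∃ d, h ∈ Hn d ∧ h ∈ satur hstd P}
  obtain ⟨t, htX, ht⟩ : ∃ t : Finset H, (t : Set H) ⊆ X ∧ Submodule.span S (t : Set H)
      = Submodule.span S X := by
    obtain ⟨t, h1, h2⟩ := Submodule.fg_span_iff_fg_span_finset_subset X |>.1
      (IsNoetherian.noetherian (Submodule.span S X))
    exact ⟨t, h1, h2.symm⟩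
  have : ∀ h : H, ∃ (d : Fin r → ℤ) (k : ℕ), h ∈ t → h ∈ Hn d ∧ ∀ s ∈ 𝒜 (fun _ => k), s • h ∈ P := by
    intro h
    by_cases hh : h ∈ t
    · obtain ⟨d, h1, k, hk⟩ := htX hh
      exact ⟨d, k, fun _ => ⟨h1, hk⟩⟩
    · exact ⟨0, 0, fun h => absurd h hh⟩
  choose d k hdk using this
  refine ⟨fun i => ∑ h ∈ t, ((d h i).toNat + k h), fun n hn h hh hs => ?_⟩
  have hle : ∀ h ∈ t, ∀ i, d h i + k h ≤ n i := by
    intro h hh i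
    have h1 : (d h i).toNat + k h ≤ ∑ h ∈ t, ((d h i).toNat + k h) :=
      Finset.single_le_sum (f := fun h => (d h i).toNat + k h) (fun _ _ => Nat.zero_le _) hh
    have h2 := hn i
    have h3 := Int.self_le_toNat (d h i)
    have h4 : (((d h i).toNat + k h : ℕ) : ℤ) ≤ n i := le_trans (by exact_mod_cast h1) h2
    push_cast at h4
    linarith
  have key : ∀ g ∈ Submodule.span S (t : Set H), ∀ s : S, π n (s • g) ∈ P := by
    intro g hg
    induction hg using Submodule.span_induction with
    | zero => intro s; simp
    | add a b _ _ ha hb => intro s; rw [smul_add, map_add]; exact P.add_mem (ha s) (hb s)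
    | smul c a _ ha => intro s; rw [smul_smul]; exact ha _
    | mem g hg =>
      intro s
      obtain ⟨h1, h2⟩ := hdk g hg
      induction s using DirectSum.Decomposition.inductionOn 𝒜 with
      | zero => simp
      | add a b ha hb => rw [add_smul, map_add]; exact P.add_mem ha hb
      | @homogeneous m s =>
        have e : (s : S) • g ∈ Hn (fun i => d g i + (m i : ℤ)) := by
          have := D.smul m s s.2 (d g) g
          rw [D.self _ g h1] at this
          rw [← this]
          exact D.mem _ _
        by_cases hnm : n = fun i => d g i + (m i : ℤ)
        · rw [hnm, D.self _ _ e]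
          refine smul_mem_of_le hstd P (fun i => ?_) g h2 s s.2
          have := hle g hg i
          rw [hnm] at this
          have h5 : (k g : ℤ) ≤ m i := by linarith
          exact_mod_cast h5
        · rw [D.ne _ _ _ e hnm]; exact P.zero_mem
  have := key h (ht ▸ Submodule.subset_span ⟨n, hh, hs⟩) 1
  rwa [one_smul, D.self n h hh] at this

/-- The degree `n` part of `H / P`. -/
abbrev Qn (Hn : (Fin r → ℤ) → Submodule R H) (P : Submodule S H) (n : Fin r → ℤ) : Type u :=
  Hn n ⧸ (P.restrictScalars R).comap (Hn n).subtype

lemma exists_regular [IsNoetherianRing S] [IsNoetherian S H]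
    (J : Ideal R) (P : Submodule S H)
    (hJ : ∀ y : H, (∀ a ∈ J, a • y ∈ P) → y ∈ P) :
    ∃ x ∈ J, ∀ y : H, x • y ∈ P → y ∈ P := by
  classical
  by_contra hcon
  push Not at hcon
  have hfin := associatedPrimes.finite S (H ⧸ P)
  have hsub : (J : Set R) ⊆ ⋃ p ∈ associatedPrimes S (H ⧸ P),
      ((Ideal.comap (algebraMap R S) p : Ideal R) : Set R) := by
    intro x hx
    obtain ⟨y, hy, hyP⟩ := hcon x hx
    have : algebraMap R S x ∈ ⋃ p ∈ associatedPrimes S (H ⧸ P), (p : Set S) := by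
      rw [biUnion_associatedPrimes_eq_zero_divisors]
      refine ⟨Submodule.Quotient.mk y, by simpa using hyP, ?_⟩
      rw [← Submodule.Quotient.mk_smul, Submodule.Quotient.mk_eq_zero, algebraMap_smul]
      exact hy
    simpa using this
  obtain ⟨p, hp, hJp⟩ := (Ideal.subset_union_prime_finite hfin
    (f := fun p => Ideal.comap (algebraMap R S) p) 0 0
    (fun p hp _ _ => by have := hp.isPrime; exact Ideal.comap_isPrime _ _)).1 hsub
  obtain ⟨hpp, y, hy⟩ := isAssociatedPrime_iff.1 (AssociatedPrimes.mem_iff.1 hp)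
  obtain ⟨y, rfl⟩ := Submodule.Quotient.mk_surjective _ y
  have hyP : y ∈ P := by
    refine hJ y fun a ha => ?_
    have : algebraMap R S a ∈ p := hJp ha
    rw [hy] at this
    have h2 : a • (Submodule.Quotient.mk y : H ⧸ P) = 0 := by simpa using this
    rwa [← Submodule.Quotient.mk_smul, Submodule.Quotient.mk_eq_zero] at h2
  apply hpp.ne_top
  rw [hy, (Submodule.Quotient.mk_eq_zero P).2 hyP]
  ext; simp

theorem main_aux (hstd : ∀ n : Fin r → ℕ, 𝒜 n = ∏ i, 𝒜 (Pi.single i 1) ^ n i)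
    [GradedAlgebra 𝒜] [IsNoetherianRing S] [IsNoetherian S H] (D : GrData 𝒜 Hn π)
    (J : Ideal R) (P : Submodule S H) (hP : ∀ h ∈ P, ∀ n, π n h ∈ P) :
    ∃ (c : Fin r → ℕ) (g : ℕ∞), ∀ n : Fin r → ℤ, (∀ i, (c i : ℤ) ≤ n i) →
      gradeIdeal J (Qn Hn P n) = g := by
  induction P using WellFoundedGT.induction with
  | ind P ih =>
  by_cases hsat : satur hstd P = P
  swap
  · obtain ⟨c₁, g, h₁⟩ := ih _ (lt_of_le_of_ne (le_satur hstd P) (Ne.symm hsat))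
      (satur_hom hstd D P hP)
    obtain ⟨c₂, h₂⟩ := satur_bound hstd D P
    refine ⟨c₁ + c₂, g, fun n hn => ?_⟩
    rw [← h₁ n (fun i => le_trans (by simp) (hn i))]
    refine gradeIdeal_congr J (Submodule.quotEquivOfEq _ _ ?_)
    ext ⟨h, hh⟩
    exact ⟨fun a => le_satur hstd P a,
      fun a => h₂ n (fun i => le_trans (by simp) (hn i)) h hh a⟩
  by_cases hy : ∃ d, ∃ y ∈ Hn d, y ∉ P ∧ ∀ a ∈ J, a • y ∈ P
  · obtain ⟨d, y, hyd, hyP, hJy⟩ := hy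
    refine ⟨fun i => (d i).toNat, 0, fun n hn => ?_⟩
    set m : Fin r → ℕ := fun i => (n i - d i).toNat
    have hm : n = fun i => d i + (m i : ℤ) := by
      funext i
      have : ((d i).toNat : ℤ) ≤ n i := hn i
      simp only [m]
      have := Int.self_le_toNat (d i)
      omega
    obtain ⟨s, hs, hsy⟩ : ∃ s ∈ 𝒜 m, s • y ∉ P := by
      by_contra hcon
      push Not at hcon
      apply hyP
      rw [← hsat]
      exact ⟨∑ i, m i, fun s hs => smul_mem_of_le hstd P
        (fun i => Finset.single_le_sum (fun _ _ => Nat.zero_le _) (Finset.mem_univ i)) y hcon s hs⟩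
    have hmem : s • y ∈ Hn n := by
      have := D.smul m s hs d y
      rw [D.self _ y hyd, ← hm] at this
      rw [← this]; exact D.mem _ _
    refine gradeIdeal_eq_zero J (Submodule.Quotient.mk ⟨s • y, hmem⟩) ?_ ?_
    · rw [Ne, Submodule.Quotient.mk_eq_zero]
      exact hsy
    · intro a ha
      rw [← Submodule.Quotient.mk_smul, Submodule.Quotient.mk_eq_zero]
      change a • s • y ∈ P
      rw [← algebraMap_smul S a, smul_comm, algebraMap_smul]
      exact P.smul_mem _ (hJy a ha)
  push Not at hy
  have hall : ∀ y : H, (∀ a ∈ J, a • y ∈ P) → y ∈ P := by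
    intro y hJy
    obtain ⟨t, ht⟩ := D.sum y
    rw [ht]
    refine P.sum_mem fun n _ => ?_
    by_contra hn
    obtain ⟨a, ha, h2⟩ := hy n (π n y) (D.mem _ _) hn
    rw [← map_smul] at h2
    exact h2 (hP _ (hJy a ha) n)
  obtain ⟨x, hxJ, hx⟩ := exists_regular J P hall
  set P' : Submodule S H := P ⊔ LinearMap.range (LinearMap.lsmul S H (algebraMap R S x)) with hP'def
  have memP' : ∀ h, h ∈ P' ↔ ∃ p ∈ P, ∃ k, p + x • k = h := by
    intro h
    simp [hP'def, Submodule.mem_sup]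
  have hPP' : P ≤ P' := le_sup_left
  by_cases heq : P' = P
  · have htop : ∀ y, y ∈ P := fun y => hx y (by
      rw [← heq, memP']; exact ⟨0, P.zero_mem, y, by simp⟩)
    refine ⟨0, gradeIdeal J PUnit, fun n _ => gradeIdeal_congr J ?_⟩
    have : Subsingleton (Qn Hn P n) := by
      refine Submodule.Quotient.subsingleton_iff.2 ?_
      ext ⟨h, hh⟩
      exact ⟨fun _ => trivial, fun _ => htop h⟩
    exact LinearEquiv.ofSubsingleton _ _
  · have hP' : ∀ h ∈ P', ∀ n, π n h ∈ P' := by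
      intro h hh n
      obtain ⟨p, hp, k, rfl⟩ := (memP' h).1 hh
      rw [memP']
      exact ⟨π n p, hP p hp n, π n k, by simp⟩
    obtain ⟨c, g, hc⟩ := ih P' (lt_of_le_of_ne hPP' (Ne.symm heq)) hP'
    refine ⟨c, g + 1, fun n hn => ?_⟩
    rw [← hc n hn]
    have hreg : IsSMulRegular (Qn Hn P n) x := by
      rw [isSMulRegular_iff_right_eq_zero_of_smul]
      intro z hz
      obtain ⟨⟨z, hzn⟩, rfl⟩ := Submodule.Quotient.mk_surjective _ z
      rw [← Submodule.Quotient.mk_smul, Submodule.Quotient.mk_eq_zero] at hz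
      rw [Submodule.Quotient.mk_eq_zero]
      exact hx z hz
    rw [gradeIdeal_succ J x hxJ hreg]
    congr 1
    set A := (P.restrictScalars R).comap (Hn n).subtype
    set A' := (P'.restrictScalars R).comap (Hn n).subtype
    have hAA' : A ≤ A' := fun h hh => hPP' hh
    refine gradeIdeal_congr J ((Submodule.quotEquivOfEq _ _ ?_).trans
      (Submodule.quotientQuotientEquivQuotient A A' hAA'))
    ext z
    rw [Submodule.mem_smul_pointwise_iff_exists, Submodule.mem_map]
    constructor
    · rintro ⟨w, -, rfl⟩
      obtain ⟨w, rfl⟩ := Submodule.Quotient.mk_surjective _ w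
      exact ⟨x • w, (memP' _).2 ⟨0, P.zero_mem, w, by simp⟩, rfl⟩
    · rintro ⟨⟨w, hwn⟩, hw, rfl⟩
      obtain ⟨p, hp, k, hk⟩ := (memP' w).1 hw
      refine ⟨Submodule.Quotient.mk ⟨π n k, D.mem _ _⟩, trivial, ?_⟩
      rw [← Submodule.Quotient.mk_smul]
      refine (Submodule.Quotient.eq _).2 ?_
      change x • π n k - w ∈ P
      have : π n p + x • π n k = w := by
        rw [← map_smul, ← map_add, hk, D.self n w hwn]
      rw [← this, sub_add_cancel_right]
      exact P.neg_mem (hP p hp n)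

end GradedPart

section HomPart

variable {R S : Type u} {r : ℕ} [CommRing R] [CommRing S] [Algebra R S]
    {M : Type u} [AddCommGroup M] [Module R M] [Module S M] [IsScalarTower R S M]

/-- Projection to the degree `n` component. -/
noncomputable def projB (B : (Fin r → ℤ) → Submodule R M) [DirectSum.Decomposition B]
    (n : Fin r → ℤ) : M →ₗ[R] M :=
  (B n).subtype ∘ₗ DirectSum.component R _ _ n ∘ₗ (DirectSum.decomposeLinearEquiv B).toLinearMap

lemma projB_apply (B : (Fin r → ℤ) → Submodule R M) [DirectSum.Decomposition B]
    (n : Fin r → ℤ) (x : M) : projB B n x = DirectSum.decompose B x n := rfl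

lemma projB_smul {𝒜 : (Fin r → ℕ) → Submodule R S}
    (B : (Fin r → ℤ) → Submodule R M) [DirectSum.Decomposition B]
    (hsmul : ∀ (m : Fin r → ℕ) (n : Fin r → ℤ) (s : S) (x : M),
      s ∈ 𝒜 m → x ∈ B n → s • x ∈ B (fun i => n i + m i))
    (m : Fin r → ℕ) (s : S) (hs : s ∈ 𝒜 m) (n : Fin r → ℤ) (x : M) :
    projB B (fun i => n i + (m i : ℤ)) (s • x) = s • projB B n x := by
  induction x using DirectSum.Decomposition.inductionOn B with
  | zero => simp
  | add a b ha hb => rw [smul_add, map_add, map_add, smul_add, ha, hb]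
  | @homogeneous d x =>
    have h := hsmul m d s x hs x.2
    simp only [projB_apply]
    by_cases hd : d = n
    · subst hd
      rw [DirectSum.decompose_of_mem_same B h, DirectSum.decompose_of_mem_same B x.2]
    · rw [DirectSum.decompose_of_mem_ne B h, DirectSum.decompose_of_mem_ne B x.2 hd, smul_zero]
      intro h'
      apply hd
      funext i
      have := congrFun h' i
      simpa using this

/-- Maps into the degree `n` component. -/
def HomN (K : Type u) [AddCommGroup K] [Module R K] (B : (Fin r → ℤ) → Submodule R M)
    (n : Fin r → ℤ) : Submodule R (K →ₗ[R] M) :=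
  LinearMap.range (LinearMap.compRight R (M := K) (B n).subtype)

lemma mem_HomN {K : Type u} [AddCommGroup K] [Module R K] {B : (Fin r → ℤ) → Submodule R M}
    {n : Fin r → ℤ} {φ : K →ₗ[R] M} : φ ∈ HomN K B n ↔ ∀ k, φ k ∈ B n := by
  constructor
  · rintro ⟨g, rfl⟩ k
    exact (g k).2
  · intro h
    exact ⟨φ.codRestrict _ h, by ext; rfl⟩

lemma grData_hom {𝒜 : (Fin r → ℕ) → Submodule R S}
    (K : Type u) [AddCommGroup K] [Module R K] [Module.Finite R K]
    (B : (Fin r → ℤ) → Submodule R M) [DirectSum.Decomposition B]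
    (hsmul : ∀ (m : Fin r → ℕ) (n : Fin r → ℤ) (s : S) (x : M),
      s ∈ 𝒜 m → x ∈ B n → s • x ∈ B (fun i => n i + m i)) :
    GrData 𝒜 (HomN K B) (fun n => LinearMap.compRight R (M := K) (projB B n)) where
  mem n h := mem_HomN.2 fun k => (DirectSum.decompose B (h k) n).2
  self n h hh := by
    ext k
    exact DirectSum.decompose_of_mem_same B (mem_HomN.1 hh k)
  ne n d h hh hnd := by
    ext k
    exact DirectSum.decompose_of_mem_ne B (mem_HomN.1 hh k) hnd.symm
  smul m s hs n h := by
    ext k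
    exact projB_smul B hsmul m s hs n (h k)
  sum h := by
    classical
    obtain ⟨G, hG⟩ := Module.Finite.fg_top (R := R) (M := K)
    set t : Finset (Fin r → ℤ) := G.biUnion fun g => (DirectSum.decompose B (h g)).support
    have key : ∀ n ∉ t, ∀ k, projB B n (h k) = 0 := by
      intro n hn k
      have hk : k ∈ Submodule.span R (G : Set K) := by rw [hG]; trivial
      induction hk using Submodule.span_induction with
      | zero => simp
      | add a b _ _ ha hb => simp [ha, hb]
      | smul c a _ ha => simp [ha]
      | mem g hg =>
        by_contra hne
        apply hn
        refine Finset.mem_biUnion.2 ⟨g, hg, ?_⟩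
        rw [DFinsupp.mem_support_iff]
        intro h0
        apply hne
        rw [projB_apply, h0]
        rfl
    refine ⟨t, ?_⟩
    ext k
    rw [LinearMap.sum_apply]
    change h k = ∑ n ∈ t, projB B n (h k)
    have hs := DirectSum.sum_support_decompose B (h k)
    conv_lhs => rw [← hs]
    refine Finset.sum_subset_zero_on_sdiff (fun n hn => ?_) (fun n hn => ?_) (fun n hn => rfl)
    · by_contra hnt
      rw [DFinsupp.mem_support_iff] at hn
      exact hn (Subtype.ext (key n hnt k))
    · rw [Finset.mem_sdiff, DFinsupp.mem_support_iff, not_not] at hn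
      rw [projB_apply, hn.2]
      rfl

lemma noeth_hom [IsNoetherian S M] (K : Type u) [AddCommGroup K] [Module R K]
    [Module.Finite R K] : IsNoetherian S (K →ₗ[R] M) := by
  obtain ⟨k, g, hg⟩ := Module.Finite.exists_fin (R := R) (M := K)
  let e : (K →ₗ[R] M) →ₗ[S] (Fin k → M) :=
    { toFun := fun φ i => φ (g i)
      map_add' := fun _ _ => rfl
      map_smul' := fun _ _ => rfl }
  refine isNoetherian_of_injective e ?_
  rw [← LinearMap.ker_eq_bot, LinearMap.ker_eq_bot']
  intro φ hφ
  refine LinearMap.ext_on_range hg fun i => congrFun hφ i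

/-- The submodule of maps factoring through `f`. -/
def facSub (S : Type u) [CommRing S] [Algebra R S]
    (M : Type u) [AddCommGroup M] [Module R M] [Module S M] [IsScalarTower R S M]
    {K L : Type u} [AddCommGroup K] [Module R K] [AddCommGroup L] [Module R L]
    (f : K →ₗ[R] L) : Submodule S (K →ₗ[R] M) where
  carrier := {φ | ∃ g : L →ₗ[R] M, g ∘ₗ f = φ}
  zero_mem' := ⟨0, LinearMap.zero_comp f⟩
  add_mem' := by
    rintro _ _ ⟨a, rfl⟩ ⟨b, rfl⟩
    exact ⟨a + b, LinearMap.add_comp f b a⟩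
  smul_mem' := by
    rintro c _ ⟨a, rfl⟩
    exact ⟨c • a, rfl⟩

/-- Identification of the coherent functor value with the graded piece. -/
noncomputable def coherentEquiv (S : Type u) [CommRing S] [Algebra R S]
    {M : Type u} [AddCommGroup M] [Module R M] [Module S M] [IsScalarTower R S M]
    {K L : Type u} [AddCommGroup K] [Module R K] [AddCommGroup L] [Module R L]
    (f : K →ₗ[R] L) (B : (Fin r → ℤ) → Submodule R M) [DirectSum.Decomposition B]
    (n : Fin r → ℤ) :
    coherentApply f (B n) ≃ₗ[R] Qn (HomN K B) (facSub S M f) n := by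
  have hinj : Function.Injective (LinearMap.compRight R (M := K) (B n).subtype) := by
    intro a b hab
    ext k
    exact congrArg (fun φ => φ k) hab
  refine Submodule.Quotient.equiv _ _ (LinearEquiv.ofInjective _ hinj) ?_
  ext ⟨φ, hφ⟩
  rw [Submodule.mem_map]
  constructor
  · rintro ⟨_, ⟨g, rfl⟩, h⟩
    have h' := congrArg Subtype.val h
    exact ⟨(B n).subtype ∘ₗ g, h'⟩
  · rintro ⟨g, hg⟩
    have hg' : g ∘ₗ f = φ := hg
    let g' : L →ₗ[R] B n := (projB B n ∘ₗ g).codRestrict _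
      (fun l => (DirectSum.decompose B (g l) n).2)
    refine ⟨g' ∘ₗ f, ⟨g', rfl⟩, Subtype.ext ?_⟩
    ext k
    change projB B n (g (f k)) = φ k
    have : g (f k) = φ k := by rw [← hg']; rfl
    rw [this]
    exact DirectSum.decompose_of_mem_same B (mem_HomN.1 hφ k)

end HomPart

/-- asymptotic stability of `grade(J, F(ℳ_n))` for a finitely generated
`ℤ^r`-graded module `ℳ` over a Noetherian standard `ℕ^r`-graded ring `S` with `S_0 = R`. -/
theorem stmt4 {R : Type u} [CommRing R] [IsNoetherianRing R]
    {r : ℕ} (hr : 1 ≤ r)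
    -- the Noetherian standard ℕ^r-graded ring S with S₀ = R
    (S : Type u) [CommRing S] [Algebra R S] [IsNoetherianRing S]
    (hinj : Function.Injective (algebraMap R S))
    (𝒜 : (Fin r → ℕ) → Submodule R S) [GradedAlgebra 𝒜]
    (h0 : 𝒜 0 = 1)
    (hstd : ∀ n : Fin r → ℕ, 𝒜 n = ∏ i, 𝒜 (Pi.single i 1) ^ n i)
    -- the finitely generated ℤ^r-graded S-module ℳ with components ℬ n
    (ℳ : Type u) [AddCommGroup ℳ] [Module R ℳ] [Module S ℳ]
    [IsScalarTower R S ℳ] [Module.Finite S ℳ]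
    (ℬ : (Fin r → ℤ) → Submodule R ℳ) (hdec : DirectSum.Decomposition ℬ)
    (hsmul : ∀ (m : Fin r → ℕ) (n : Fin r → ℤ) (s : S) (x : ℳ),
      s ∈ 𝒜 m → x ∈ ℬ n → s • x ∈ ℬ (fun i => n i + m i))
    -- a nonzero ideal J of R
    (J : Ideal R) (hJ : J ≠ ⊥)
    -- the coherent functor
    {K L : Type u} [AddCommGroup K] [Module R K] [Module.Finite R K]
    [AddCommGroup L] [Module R L] [Module.Finite R L]
    (f : K →ₗ[R] L) :
    ∃ c : Fin r → ℕ, ∀ n : Fin r → ℤ, (fun i => (c i : ℤ)) ≤ n →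
      gradeIdeal J (coherentApply f (ℬ n)) =
      gradeIdeal J (coherentApply f (ℬ (fun i => (c i : ℤ)))) := by
  let _ := hdec
  have : IsNoetherian S ℳ := isNoetherian_of_isNoetherianRing_of_finite S ℳ
  have : IsNoetherian S (K →ₗ[R] ℳ) := noeth_hom (R := R) (S := S) (M := ℳ) K
  obtain ⟨c, g, hc⟩ := main_aux hstd (grData_hom K ℬ hsmul) J (facSub S ℳ f) (by
    rintro _ ⟨g, rfl⟩ n
    exact ⟨projB ℬ n ∘ₗ g, rfl⟩)
  refine ⟨c, fun n hn => ?_⟩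
  rw [gradeIdeal_congr J (coherentEquiv S f ℬ n), gradeIdeal_congr J (coherentEquiv S f ℬ _),
    hc n hn, hc _ (fun i => le_rfl)]
end

section
/- Let R be a commutative Noetherian ring, r ≥ 1 an integer, and I_1,…,I_r ideals of R. Let A → B → C be a complex of finitely generated R-modules with maps φ : A → B and ψ : B → C satisfying ψ ∘ φ = 0. Let A' ⊆ A, B' ⊆ B, C' ⊆ C be submodules with φ(A') ⊆ B' and ψ(B') ⊆ C'. Let c ∈ ℕ^r and let A_1, A_2 be submodules of A with I^c A' ⊆ A_2. For n ≥ c, since I^n A' ⊆ A_1 + I^{n−c}A_2, one has the induced complex (A_1 + I^{n−c}A_2)/I^n A' → B/I^n B' → C/I^n C' with maps φ(n), ψ(n) induced by φ and ψ; let H(n) := ker(ψ(n)) / im(φ(n)) be its homology. Then there exist d ∈ ℕ^r with d ≥ c, a finitely generated R-module T, and submodules U, V, W of T with W ⊆ V, such that U is isomorphic to ker(ψ)/φ(A_1) and for all n ≥ d there is an R-module isomorphism H(n) ≅ (U + I^{n−d}V)/(I^{n−d}W). -/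
universe u

/-- The product ideal `I^n = I_1^{n_1} ⋯ I_r^{n_r}`. -/
abbrev prodPow {R : Type u} [CommRing R] {r : ℕ} (I : Fin r → Ideal R)
    (n : Fin r → ℕ) : Ideal R :=
  ∏ i, I i ^ n i

section helpers

variable {R : Type u} [CommRing R] {r : ℕ}

theorem prodPow_add (I : Fin r → Ideal R) (m n : Fin r → ℕ) :
    prodPow I (m + n) = prodPow I m * prodPow I n := by
  simp [prodPow, pow_add, Finset.prod_mul_distrib]

/-- The multi-Rees algebra. -/
def multiRees (I : Fin r → Ideal R) : Subalgebra R (MvPolynomial (Fin r) R) where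
  carrier := {f | ∀ m : Fin r →₀ ℕ, f.coeff m ∈ prodPow I m}
  mul_mem' {f g} hf hg m := by
    rw [MvPolynomial.coeff_mul]
    refine Ideal.sum_mem _ ?_
    rintro ⟨j, k⟩ e
    rw [← Finset.HasAntidiagonal.mem_antidiagonal.mp e, Finsupp.coe_add, prodPow_add]
    exact Ideal.mul_mem_mul (hf j) (hg k)
  add_mem' {f g} hf hg m := by
    rw [MvPolynomial.coeff_add]
    exact Ideal.add_mem _ (hf m) (hg m)
  algebraMap_mem' a m := by
    rw [MvPolynomial.algebraMap_eq, MvPolynomial.coeff_C]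
    split_ifs with h
    · subst h
      have h1 : prodPow I ((0 : Fin r →₀ ℕ) : Fin r → ℕ) = 1 := by
        simp only [prodPow, Finsupp.coe_zero, Pi.zero_apply, pow_zero, Finset.prod_const_one]
      rw [h1, Ideal.one_eq_top]
      trivial
    · simp

theorem monomial_mem_multiRees {I : Fin r → Ideal R} {n : Fin r →₀ ℕ} {a : R}
    (ha : a ∈ prodPow I n) : MvPolynomial.monomial n a ∈ multiRees I := by
  intro m
  rw [MvPolynomial.coeff_monomial]
  split_ifs with h
  · exact h ▸ ha
  · simp

/-- The degree `n` coefficients of monomials in a subalgebra. -/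
noncomputable def coeffIdeal (S : Subalgebra R (MvPolynomial (Fin r) R)) (n : Fin r →₀ ℕ) : Ideal R :=
  Submodule.comap (MvPolynomial.monomial n) (Subalgebra.toSubmodule S)

theorem mem_coeffIdeal {S : Subalgebra R (MvPolynomial (Fin r) R)} {n : Fin r →₀ ℕ} {a : R} :
    a ∈ coeffIdeal S n ↔ MvPolynomial.monomial n a ∈ S := Iff.rfl

theorem coeffIdeal_mul (S : Subalgebra R (MvPolynomial (Fin r) R)) (m n : Fin r →₀ ℕ) :
    coeffIdeal S m * coeffIdeal S n ≤ coeffIdeal S (m + n) := by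
  rw [Ideal.mul_le]
  intro a ha b hb
  rw [mem_coeffIdeal] at *
  rw [← MvPolynomial.monomial_mul]
  exact S.mul_mem ha hb

theorem prodPow_le_coeffIdeal (I : Fin r → Ideal R) (S : Subalgebra R (MvPolynomial (Fin r) R))
    (h : ∀ i, I i ≤ coeffIdeal S (Finsupp.single i 1)) (n : Fin r →₀ ℕ) :
    prodPow I n ≤ coeffIdeal S n := by
  have h0 : (1 : Ideal R) ≤ coeffIdeal S 0 := by
    intro a _
    rw [mem_coeffIdeal]
    exact S.algebraMap_mem a
  have h1 : ∀ i k, I i ^ k ≤ coeffIdeal S (Finsupp.single i k) := by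
    intro i k
    induction k with
    | zero => simpa using h0
    | succ k ih =>
      rw [pow_succ, Finsupp.single_add]
      exact (Ideal.mul_mono ih (h i)).trans (coeffIdeal_mul S _ _)
  have h2 : ∀ s : Finset (Fin r), ∏ i ∈ s, I i ^ n i ≤
      coeffIdeal S (∑ i ∈ s, Finsupp.single i (n i)) := by
    intro s
    induction s using Finset.induction_on with
    | empty => simpa using h0
    | insert i s hi ih =>
      rw [Finset.prod_insert hi, Finset.sum_insert hi]
      exact (Ideal.mul_mono (h1 _ _) ih).trans (coeffIdeal_mul S _ _)
  have := h2 Finset.univ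
  rwa [Finsupp.univ_sum_single] at this

theorem multiRees_fg [IsNoetherianRing R] (I : Fin r → Ideal R) : (multiRees I).FG := by
  classical
  choose s hs using fun i => IsNoetherian.noetherian (I i)
  let t : Finset (MvPolynomial (Fin r) R) :=
    Finset.univ.biUnion fun i => (s i).image (MvPolynomial.monomial (Finsupp.single i 1))
  refine ⟨t, le_antisymm ?_ ?_⟩
  · refine Algebra.adjoin_le ?_
    intro f hf
    simp only [t, Finset.coe_biUnion, Set.mem_iUnion, Finset.coe_image] at hf
    obtain ⟨i, -, a, ha, rfl⟩ := hf
    refine monomial_mem_multiRees ?_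
    have hai : a ∈ I i := by
      rw [← hs i]; exact Submodule.subset_span ha
    have : prodPow I (Finsupp.single i 1) = I i := by
      rw [prodPow, Finset.prod_eq_single i]
      · simp
      · intro j _ hj
        rw [Finsupp.single_eq_of_ne hj]
        simp
      · simp
    rwa [this]
  · intro f hf
    rw [f.as_sum]
    refine Subalgebra.sum_mem _ fun m _ => ?_
    refine mem_coeffIdeal.mp (prodPow_le_coeffIdeal I _ ?_ m (hf m))
    intro i
    rw [← hs i]
    refine Submodule.span_le.mpr ?_
    intro a ha
    refine Algebra.subset_adjoin ?_
    simp only [t, Finset.coe_biUnion, Set.mem_iUnion, Finset.coe_image]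
    exact ⟨i, by simp, a, ha, rfl⟩

theorem multiRees_noeth [IsNoetherianRing R] (I : Fin r → Ideal R) :
    IsNoetherianRing (multiRees I) := by
  have : Algebra.FiniteType R (multiRees I) := ⟨(multiRees I).fg_top.mpr (multiRees_fg I)⟩
  exact Algebra.FiniteType.isNoetherianRing R _

/-- The ideal of the multi-Rees algebra of a family of coefficient ideals. -/
def gradedIdeal (I : Fin r → Ideal R) (Q : (Fin r →₀ ℕ) → Ideal R)
    (hQ : ∀ m n : Fin r →₀ ℕ, prodPow I m * Q n ≤ Q (m + n)) : Ideal (multiRees I) where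
  carrier := {f | ∀ m, f.1.coeff m ∈ Q m}
  zero_mem' m := by simp
  add_mem' {f g} hf hg m := by
    rw [Subalgebra.coe_add, MvPolynomial.coeff_add]
    exact Ideal.add_mem _ (hf m) (hg m)
  smul_mem' f g hg m := by
    rw [smul_eq_mul, Subalgebra.coe_mul, MvPolynomial.coeff_mul]
    refine Ideal.sum_mem _ ?_
    rintro ⟨j, k⟩ e
    rw [← Finset.HasAntidiagonal.mem_antidiagonal.mp e]
    exact hQ _ _ (Ideal.mul_mem_mul (f.2 j) (hg k))

theorem mem_gradedIdeal {I : Fin r → Ideal R} {Q : (Fin r →₀ ℕ) → Ideal R}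
    {hQ : ∀ m n : Fin r →₀ ℕ, prodPow I m * Q n ≤ Q (m + n)} {f : multiRees I} :
    f ∈ gradedIdeal I Q hQ ↔ ∀ m, f.1.coeff m ∈ Q m := Iff.rfl

theorem prodPow_mul_inf_le (I : Fin r → Ideal R) (J N : Ideal R) (m n : Fin r → ℕ) :
    prodPow I m * (prodPow I n * J ⊓ N) ≤ prodPow I (m + n) * J ⊓ N := by
  refine le_inf ?_ ?_
  · rw [prodPow_add, mul_assoc]
    exact Ideal.mul_mono_right inf_le_left
  · exact Ideal.mul_le_right.trans inf_le_right

/-- Multi-ideal Artin-Rees for ideals. -/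
theorem artinRees_ring [IsNoetherianRing R] (I : Fin r → Ideal R) (J N : Ideal R) :
    ∃ e : Fin r → ℕ, ∀ n, e ≤ n →
      prodPow I n * J ⊓ N ≤ prodPow I (n - e) * (prodPow I e * J ⊓ N) := by
  classical
  let G : Ideal (multiRees I) := gradedIdeal I (fun m => prodPow I m * J ⊓ N)
    (fun m n => by
      rw [Finsupp.coe_add]; exact prodPow_mul_inf_le I J N m n)
  have := multiRees_noeth I
  obtain ⟨s, hs⟩ := IsNoetherian.noetherian G
  let e : Fin r → ℕ := fun i => s.sup fun g => MvPolynomial.degreeOf i g.1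
  refine ⟨e, fun n hn => ?_⟩
  let Q : (Fin r →₀ ℕ) → Ideal R := fun n =>
    ⨆ k : {k : Fin r → ℕ // k ≤ n ∧ k ≤ e}, prodPow I (n - k.1) * (prodPow I k.1 * J ⊓ N)
  have hQ : ∀ m n : Fin r →₀ ℕ, prodPow I m * Q n ≤ Q (m + n) := by
    intro m n
    simp only [Q]
    rw [Ideal.mul_iSup]
    refine iSup_le fun k => ?_
    refine le_trans ?_ (le_iSup _ ⟨k.1, k.2.1.trans ?_, k.2.2⟩)
    · rw [← mul_assoc, ← prodPow_add]
      refine Ideal.mul_mono_left (le_of_eq ?_)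
      congr 1
      ext i
      have : k.1 i ≤ n i := k.2.1 i
      simp only [Finsupp.coe_add, Pi.sub_apply, Pi.add_apply]
      omega
    · intro i; simp
  have hGK : G ≤ gradedIdeal I Q hQ := by
    rw [← hs]
    refine Submodule.span_le.mpr ?_
    intro g hg m
    by_cases h0 : g.1.coeff m = 0
    · rw [h0]; exact Ideal.zero_mem _
    have hgG : g ∈ G := by rw [← hs]; exact Submodule.subset_span hg
    have hme : (m : Fin r → ℕ) ≤ e := by
      intro i
      refine le_trans ?_ (Finset.le_sup (f := fun g : multiRees I => MvPolynomial.degreeOf i g.1) hg)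
      exact MvPolynomial.monomial_le_degreeOf i (MvPolynomial.mem_support_iff.mpr h0)
    refine (le_iSup (fun k : {k : Fin r → ℕ // k ≤ m ∧ k ≤ e} =>
      prodPow I (m - k.1) * (prodPow I k.1 * J ⊓ N)) ⟨m, le_rfl, hme⟩) ?_
    have := mem_gradedIdeal.mp hgG m
    have h1 : prodPow I ((m : Fin r → ℕ) - m) = 1 := by
      simp only [prodPow, tsub_self, Pi.zero_apply, pow_zero, Finset.prod_const_one]
    rw [h1, one_mul]
    exact this
  intro x hx
  let n' : Fin r →₀ ℕ := Finsupp.equivFunOnFinite.symm n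
  have hn' : (n' : Fin r → ℕ) = n := by simp [n']
  have hxI : x ∈ prodPow I n := Ideal.mul_le_left hx.1
  have hxm : (⟨MvPolynomial.monomial n' x, monomial_mem_multiRees
      (by rw [hn']; exact hxI)⟩ : multiRees I) ∈ G := by
    intro m
    simp only [MvPolynomial.coeff_monomial]
    split_ifs with h
    · rw [← h, hn']; exact hx
    · exact Ideal.zero_mem _
  have h1 := mem_gradedIdeal.mp (hGK hxm) n'
  simp only [MvPolynomial.coeff_monomial, if_true] at h1
  have h2 : Q n' ≤ prodPow I (n - e) * (prodPow I e * J ⊓ N) := by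
    refine iSup_le fun k => ?_
    have h3 : (n' : Fin r → ℕ) - k.1 = (n - e) + (e - k.1) := by
      ext i
      have h4 : k.1 i ≤ e i := k.2.2 i
      have h5 : e i ≤ n i := hn i
      have h6 : n' i = n i := congrFun hn' i
      simp only [Pi.sub_apply, Pi.add_apply, h6]
      omega
    rw [h3, prodPow_add, mul_assoc]
    refine Ideal.mul_mono_right ((prodPow_mul_inf_le I J N _ _).trans (le_of_eq ?_))
    rw [tsub_add_cancel_of_le k.2.2]
  exact h2 h1

variable {M : Type u} [AddCommGroup M] [Module R M] [Module Rᵐᵒᵖ M] [IsCentralScalar R M]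

/-- A submodule viewed as an ideal of the idealization. -/
def inrIdeal (N : Submodule R M) : Ideal (TrivSqZeroExt R M) where
  carrier := {x | x.fst = 0 ∧ x.snd ∈ N}
  zero_mem' := by simp
  add_mem' {x y} hx hy := by
    refine ⟨by simp [hx.1, hy.1], ?_⟩
    rw [TrivSqZeroExt.snd_add]
    exact N.add_mem hx.2 hy.2
  smul_mem' a x hx := by
    refine ⟨by simp [hx.1], ?_⟩
    simp only [smul_eq_mul, TrivSqZeroExt.snd_mul, hx.1, MulOpposite.op_zero, zero_smul, add_zero]
    exact N.smul_mem _ hx.2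

theorem mem_inrIdeal {N : Submodule R M} {x : TrivSqZeroExt R M} :
    x ∈ inrIdeal N ↔ x.fst = 0 ∧ x.snd ∈ N := Iff.rfl

theorem inr_mem_inrIdeal {N : Submodule R M} {x : M} :
    (TrivSqZeroExt.inr x : TrivSqZeroExt R M) ∈ inrIdeal N ↔ x ∈ N := by
  simp [mem_inrIdeal]

theorem inrIdeal_inf (N P : Submodule R M) : inrIdeal (N ⊓ P) = inrIdeal N ⊓ inrIdeal P := by
  ext x
  simp only [Submodule.mem_inf, mem_inrIdeal]
  tauto

theorem map_mul_inrIdeal (I : Ideal R) (N : Submodule R M) :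
    Ideal.map (TrivSqZeroExt.inlHom R M) I * inrIdeal N = inrIdeal (I • N) := by
  refine le_antisymm ?_ ?_
  · rw [Ideal.mul_le]
    intro a ha x hx
    have h1 : Ideal.map (TrivSqZeroExt.inlHom R M) I ≤
        Ideal.comap (TrivSqZeroExt.fstHom R R M) I := by
      rw [Ideal.map_le_iff_le_comap]
      intro y hy
      simpa using hy
    have h2 : a.fst ∈ I := by simpa using h1 ha
    refine ⟨by simp [hx.1], ?_⟩
    simp only [TrivSqZeroExt.snd_mul, hx.1, MulOpposite.op_zero, zero_smul, add_zero]
    exact Submodule.smul_mem_smul h2 hx.2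
  · rintro x ⟨hx1, hx2⟩
    have hx : x = TrivSqZeroExt.inr x.snd := by
      ext <;> simp [hx1]
    rw [hx]
    refine Submodule.smul_induction_on hx2 ?_ ?_
    · intro a ha y hy
      have : (TrivSqZeroExt.inr (a • y) : TrivSqZeroExt R M) =
          TrivSqZeroExt.inlHom R M a * TrivSqZeroExt.inr y := by
        simp [TrivSqZeroExt.inl_mul_inr]
      rw [this]
      exact Ideal.mul_mem_mul (Ideal.mem_map_of_mem _ ha) (inr_mem_inrIdeal.mpr hy)
    · intro y z hy hz
      rw [TrivSqZeroExt.inr_add]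
      exact Ideal.add_mem _ hy hz

end helpers

section helpers2

variable {R : Type u} [CommRing R] {r : ℕ} {M : Type u} [AddCommGroup M] [Module R M]

/-- Multi-ideal Artin-Rees. -/
theorem artinRees_module [IsNoetherianRing R] [Module.Finite R M] (I : Fin r → Ideal R)
    (J N : Submodule R M) :
    ∃ e : Fin r → ℕ, ∀ n, e ≤ n →
      prodPow I n • J ⊓ N ≤ prodPow I (n - e) • (prodPow I e • J ⊓ N) := by
  let _ : Module Rᵐᵒᵖ M := Module.compHom M ((RingHom.id R).fromOpposite fun _ _ => mul_comm _ _)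
  have : IsCentralScalar R M := ⟨fun _ _ => rfl⟩
  have : Module.Finite R (TrivSqZeroExt R M) :=
    inferInstanceAs (Module.Finite R (R × M))
  have : IsNoetherianRing (TrivSqZeroExt R M) := IsNoetherianRing.of_finite R _
  obtain ⟨e, he⟩ := artinRees_ring (fun i => Ideal.map (TrivSqZeroExt.inlHom R M) (I i))
    (inrIdeal J) (inrIdeal N)
  refine ⟨e, fun n hn x hx => ?_⟩
  have hp : ∀ n, prodPow (fun i => Ideal.map (TrivSqZeroExt.inlHom R M) (I i)) n =
      Ideal.map (TrivSqZeroExt.inlHom R M) (prodPow I n) := by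
    intro n
    simp only [prodPow]
    rw [← Ideal.mapHom_apply, map_prod]
    simp [Ideal.map_pow]
  have h := he n hn
  simp only [hp, map_mul_inrIdeal, ← inrIdeal_inf] at h
  exact inr_mem_inrIdeal.mp (h (inr_mem_inrIdeal.mpr hx))

theorem subquot_equiv {M' : Type u} [AddCommGroup M'] [Module R M'] (f : M →ₗ[R] M')
    (P Q : Submodule R M) (P' Q' : Submodule R M') (hP : P' = Submodule.map f P)
    (hQ : Q' = Submodule.map f Q) (hk : LinearMap.ker f ≤ Q) :
    Nonempty ((P ⧸ Submodule.comap P.subtype Q) ≃ₗ[R]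
      (P' ⧸ Submodule.comap P'.subtype Q')) := by
  subst hP hQ
  let g := (Submodule.comap (Submodule.map f P).subtype (Submodule.map f Q)).mkQ ∘ₗ
    f.submoduleMap P
  have hg : Function.Surjective g :=
    (Submodule.mkQ_surjective _).comp (f.submoduleMap_surjective P)
  have hker : Submodule.comap P.subtype Q = LinearMap.ker g := by
    rw [LinearMap.ker_comp, Submodule.ker_mkQ]
    ext x
    have h1 : Submodule.comap f (Submodule.map f Q) = Q := by
      rw [Submodule.comap_map_eq, sup_eq_left.mpr hk]
    have h2 : (x : M) ∈ Q ↔ f x ∈ Submodule.map f Q := by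
      rw [← Submodule.mem_comap, h1]
    exact h2
  exact ⟨(Submodule.quotEquivOfEq _ _ hker).trans (g.quotKerEquivOfSurjective hg)⟩

theorem quot_equiv_map {M' : Type u} [AddCommGroup M'] [Module R M'] (f : M →ₗ[R] M')
    (P : Submodule R M) :
    Nonempty (Submodule.map f P ≃ₗ[R] (P ⧸ Submodule.comap P.subtype (LinearMap.ker f))) := by
  have hker : Submodule.comap P.subtype (LinearMap.ker f) = LinearMap.ker (f.submoduleMap P) := by
    ext x
    simp [LinearMap.mem_ker, Subtype.ext_iff]
  exact ⟨((Submodule.quotEquivOfEq _ _ hker).trans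
    ((f.submoduleMap P).quotKerEquivOfSurjective (f.submoduleMap_surjective P))).symm⟩

end helpers2

/-- the homology `H(n)` of the induced complex
`(A₁ + I^{n−c}A₂)/IⁿA' → B/IⁿB' → C/IⁿC'` (presented canonically as the subquotient
`ψ⁻¹(IⁿC') / (φ(A₁ + I^{n−c}A₂) + IⁿB')` of `B`) is eventually of the form
`(U + I^{n−d}V)/(I^{n−d}W)` with `U ≅ ker ψ / φ(A₁)` and `W ⊆ V` submodules of a
finitely generated module `T`. -/
theorem stmt7 {R : Type u} [CommRing R] [IsNoetherianRing R]
    {r : ℕ} (hr : 1 ≤ r) (I : Fin r → Ideal R)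
    {A B C : Type u}
    [AddCommGroup A] [Module R A] [Module.Finite R A]
    [AddCommGroup B] [Module R B] [Module.Finite R B]
    [AddCommGroup C] [Module R C] [Module.Finite R C]
    (φ : A →ₗ[R] B) (ψ : B →ₗ[R] C) (hcx : ψ ∘ₗ φ = 0)
    (A' : Submodule R A) (B' : Submodule R B) (C' : Submodule R C)
    (hA' : Submodule.map φ A' ≤ B') (hB' : Submodule.map ψ B' ≤ C')
    (c : Fin r → ℕ) (A₁ A₂ : Submodule R A)
    (hA₂ : prodPow I c • A' ≤ A₂) :
    ∃ d : Fin r → ℕ, c ≤ d ∧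
    ∃ (T : Type u) (_ : AddCommGroup T) (_ : Module R T) (_ : Module.Finite R T)
      (U V W : Submodule R T),
      W ≤ V ∧
      Nonempty (U ≃ₗ[R]
        (↥(LinearMap.ker ψ) ⧸ Submodule.comap (LinearMap.ker ψ).subtype
          (Submodule.map φ A₁))) ∧
      ∀ n : Fin r → ℕ, d ≤ n →
        Nonempty (
          -- H(n) = ker(ψ(n)) / im(φ(n)), presented as a subquotient of B
          (↥(Submodule.comap ψ (prodPow I n • C')) ⧸
            Submodule.comap (Submodule.comap ψ (prodPow I n • C')).subtype
              (Submodule.map φ (A₁ ⊔ prodPow I (n - c) • A₂) ⊔ prodPow I n • B'))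
          ≃ₗ[R]
          (↥(U ⊔ prodPow I (n - d) • V) ⧸
            Submodule.comap (U ⊔ prodPow I (n - d) • V).subtype
              (prodPow I (n - d) • W))) := by
  obtain ⟨e, he⟩ := artinRees_module I C' (LinearMap.range ψ)
  let d : Fin r → ℕ := c ⊔ e
  have hcd : c ≤ d := le_sup_left
  have hed : e ≤ d := le_sup_right
  have hAR : ∀ n, d ≤ n → prodPow I n • C' ⊓ LinearMap.range ψ ≤
      prodPow I (n - d) • (prodPow I d • C' ⊓ LinearMap.range ψ) := by
    intro n hn
    refine (he n (hed.trans hn)).trans ?_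
    have h1 : n - e = (n - d) + (d - e) := by
      ext i
      have h4 : d i ≤ n i := hn i
      have h5 : e i ≤ d i := hed i
      simp only [Pi.sub_apply, Pi.add_apply]
      omega
    rw [h1, prodPow_add, mul_smul]
    refine smul_mono_right _ (le_inf ?_ ?_)
    · have h2 : prodPow I d = prodPow I (d - e) * prodPow I e := by
        rw [← prodPow_add, tsub_add_cancel_of_le hed]
      rw [h2, mul_smul]
      exact smul_mono_right _ inf_le_left
    · exact Submodule.smul_le_right.trans inf_le_right
  have hker : ∀ D : Submodule R A, Submodule.map φ D ≤ LinearMap.ker ψ := by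
    rintro D _ ⟨a, -, rfl⟩
    exact LinearMap.congr_fun hcx a
  have hkc : ∀ D : Submodule R C, LinearMap.ker ψ ≤ Submodule.comap ψ D := by
    intro D x hx
    rw [Submodule.mem_comap, LinearMap.mem_ker.mp hx]
    exact D.zero_mem
  have hB : ∀ n, prodPow I n • B' ≤ Submodule.comap ψ (prodPow I n • C') := by
    intro n
    rw [← Submodule.map_le_iff_le_comap, Submodule.map_smul'']
    exact smul_mono_right _ hB'
  let V₀ : Submodule R B := Submodule.comap ψ (prodPow I d • C')
  let W₀ : Submodule R B := prodPow I (d - c) • Submodule.map φ A₂ ⊔ prodPow I d • B'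
  let F : Submodule R B := Submodule.map φ A₁
  have hV : ∀ n, d ≤ n → Submodule.comap ψ (prodPow I n • C') =
      LinearMap.ker ψ ⊔ prodPow I (n - d) • V₀ := by
    intro n hn
    have hmul : prodPow I n = prodPow I (n - d) * prodPow I d := by
      rw [← prodPow_add, tsub_add_cancel_of_le hn]
    refine le_antisymm ?_ (sup_le (hkc _) ?_)
    · rw [sup_comm, ← Submodule.comap_map_eq, Submodule.map_smul'']
      intro x hx
      have := hAR n hn ⟨hx, ⟨x, rfl⟩⟩
      rw [Submodule.mem_comap]
      simpa only [V₀, Submodule.map_comap_eq, inf_comm] using this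
    · rw [← Submodule.map_le_iff_le_comap, Submodule.map_smul'', hmul, mul_smul]
      exact smul_mono_right _ (Submodule.map_comap_le _ _)
  have hW : ∀ n, d ≤ n → Submodule.map φ (A₁ ⊔ prodPow I (n - c) • A₂) ⊔ prodPow I n • B' =
      F ⊔ prodPow I (n - d) • W₀ := by
    intro n hn
    have h1 : n - c = (n - d) + (d - c) := by
      ext i
      have h4 : d i ≤ n i := hn i
      have h5 : c i ≤ d i := hcd i
      simp only [Pi.sub_apply, Pi.add_apply]
      omega
    have hmul : prodPow I n = prodPow I (n - d) * prodPow I d := by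
      rw [← prodPow_add, tsub_add_cancel_of_le hn]
    rw [h1, prodPow_add, hmul, Submodule.map_sup, Submodule.map_smul'', mul_smul, mul_smul,
      sup_assoc, ← Submodule.smul_sup]
  let q := F.mkQ
  refine ⟨d, hcd, B ⧸ F, inferInstance, inferInstance, inferInstance,
    Submodule.map q (LinearMap.ker ψ), Submodule.map q V₀, Submodule.map q W₀,
    Submodule.map_mono (sup_le ?_ (hB d)), ?_, fun n hn => ?_⟩
  · exact Submodule.smul_le_right.trans ((hker _).trans (hkc _))
  · have h := quot_equiv_map q (LinearMap.ker ψ)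
    rwa [show LinearMap.ker q = F from Submodule.ker_mkQ F] at h
  · rw [hW n hn, hV n hn]
    refine subquot_equiv q _ _ _ _ ?_ ?_ ?_
    · rw [Submodule.map_sup, Submodule.map_smul'']
    · have hF : Submodule.map q F = ⊥ := by simp [q]
      rw [Submodule.map_sup F, hF, bot_sup_eq, Submodule.map_smul'']
    · rw [show LinearMap.ker q = F from Submodule.ker_mkQ F]
      exact le_sup_left
end
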